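/- arXiv:2507.01983 — 4 statements merged into one kernel-verified Lean document; each statement's English description precedes it below -/
import Mathlib

section
/- Let 0 < β < 1, λ > 0, α ≥ 0, and ξ ∈ ℝ. Then the function x ↦ (e^{iξx} − 1) · α · e^{−λx} · x^{−(1+β)} is (Lebesgue) integrable on (0, ∞), and ∫_0^∞ (e^{iξx} − 1) · α · e^{−λx} · x^{−(1+β)} dx = α · Γ(−β) · ((λ − iξ)^β − λ^β), where Γ is the Gamma function (evaluated at the negative real number −β via its standard extension) and the complex power z^β is taken with the principal branch. -/
open MeasureTheory Set

/-- The integral of `x ^ (-β) e^{-mx}` over `(0, ∞)` converges for `β < 1` and `0 < m`. -/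
lemma integrableOn_exp_neg_mul_rpow_neg {β m : ℝ} (hβ1 : β < 1) (hm : 0 < m) :
    IntegrableOn (fun x : ℝ => Real.exp (-m * x) * x ^ (-β)) (Ioi 0) := by
  have h := integrableOn_rpow_mul_exp_neg_mul_rpow (p := 1) (s := -β) (by linarith) one_pos hm
  simpa only [Real.rpow_one, mul_comm] using h

lemma hasDerivAt_cexp_neg_mul (z : ℂ) (x : ℝ) :
    HasDerivAt (fun z : ℂ => Complex.exp (-z * x)) (-(x * Complex.exp (-z * x))) z := by
  convert! ((hasDerivAt_neg z).mul_const (x : ℂ)).cexp using 1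
  ring

lemma norm_cexp_neg_mul_le {m x : ℝ} {z : ℂ} (hz : m ≤ z.re) (hx : 0 < x) :
    ‖Complex.exp (-z * x)‖ ≤ Real.exp (-m * x) := by
  rw [Complex.norm_exp, Real.exp_le_exp]
  simp only [Complex.re_mul_ofReal, Complex.neg_re]
  gcongr

lemma norm_cexp_neg_mul_sub_le {m x : ℝ} {z w : ℂ} (hz : m ≤ z.re) (hw : m ≤ w.re) (hx : 0 < x) :
    ‖Complex.exp (-z * x) - Complex.exp (-w * x)‖ ≤ x * Real.exp (-m * x) * ‖z - w‖ := by
  refine (convex_halfSpace_re_ge m).norm_image_sub_le_of_norm_hasDerivWithin_le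
    (f := fun z : ℂ => Complex.exp (-z * x))
    (fun u _ => (hasDerivAt_cexp_neg_mul u x).hasDerivWithinAt) (fun u hu => ?_) hw hz
  rw [norm_neg, norm_mul, Complex.norm_real, Real.norm_of_nonneg hx.le]
  exact mul_le_mul_of_nonneg_left (norm_cexp_neg_mul_le hu hx) hx.le

lemma mul_rpow_neg_one_add {x : ℝ} (hx : 0 < x) (β : ℝ) : x * x ^ (-(1 + β)) = x ^ (-β) := by
  nth_rewrite 1 [← Real.rpow_one x]
  rw [← Real.rpow_add hx]
  congr 1
  ring

lemma aestronglyMeasurable_mul_ofReal_rpow {f : ℝ → ℂ} (hf : Continuous f) (s : ℝ) :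
    AEStronglyMeasurable (fun x : ℝ => f x * ((x ^ s : ℝ) : ℂ)) (volume.restrict (Ioi 0)) := by
  refine ContinuousOn.aestronglyMeasurable (fun x hx => ContinuousAt.continuousWithinAt ?_)
    measurableSet_Ioi
  exact hf.continuousAt.mul (Complex.continuous_ofReal.continuousAt.comp
    (Real.continuousAt_rpow_const x s (Or.inl (ne_of_gt hx))))

lemma integrableOn_cexp_sub_mul_rpow {β : ℝ} (hβ1 : β < 1) {z w : ℂ}
    (hz : 0 < z.re) (hw : 0 < w.re) :
    IntegrableOn (fun x : ℝ => (Complex.exp (-z * x) - Complex.exp (-w * x)) *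
      ((x ^ (-(1 + β)) : ℝ) : ℂ)) (Ioi 0) := by
  refine ((integrableOn_exp_neg_mul_rpow_neg hβ1 (lt_min hz hw)).mul_const ‖z - w‖).mono'
    (aestronglyMeasurable_mul_ofReal_rpow (by fun_prop) _)
    ((ae_restrict_mem measurableSet_Ioi).mono fun x (hx : 0 < x) => ?_)
  rw [norm_mul, Complex.norm_real, Real.norm_of_nonneg (by positivity), ← mul_rpow_neg_one_add hx β]
  calc _ ≤ x * Real.exp (-min z.re w.re * x) * ‖z - w‖ * x ^ (-(1 + β)) := by
        gcongr
        exact norm_cexp_neg_mul_sub_le (min_le_left _ _) (min_le_right _ _) hx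
    _ = _ := by ring

lemma hasDerivAt_integral_cexp_sub_mul_rpow {β : ℝ} (hβ1 : β < 1) {z w : ℂ}
    (hz : 0 < z.re) (hw : 0 < w.re) :
    HasDerivAt (fun z : ℂ => ∫ x in Ioi (0 : ℝ),
        (Complex.exp (-z * x) - Complex.exp (-w * x)) * ((x ^ (-(1 + β)) : ℝ) : ℂ))
      (∫ x in Ioi (0 : ℝ), -Complex.exp (-z * x) * ((x ^ (-β) : ℝ) : ℂ)) z := by
  have hs : {u : ℂ | z.re / 2 < u.re} ∈ nhds z :=
    (isOpen_lt continuous_const Complex.continuous_re).mem_nhds (half_lt_self hz)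
  refine (hasDerivAt_integral_of_dominated_loc_of_deriv_le
    (F := fun (z : ℂ) (x : ℝ) => (Complex.exp (-z * x) - Complex.exp (-w * x)) *
      ((x ^ (-(1 + β)) : ℝ) : ℂ))
    (F' := fun z x => -Complex.exp (-z * x) * ((x ^ (-β) : ℝ) : ℂ))
    (bound := fun x => Real.exp (-(z.re / 2) * x) * x ^ (-β)) hs
    (Filter.Eventually.of_forall fun u =>
      aestronglyMeasurable_mul_ofReal_rpow (by fun_prop) _)
    (integrableOn_cexp_sub_mul_rpow hβ1 hz hw)
    (aestronglyMeasurable_mul_ofReal_rpow (by fun_prop) _)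
    ((ae_restrict_mem measurableSet_Ioi).mono fun x (hx : 0 < x) u hu => ?_)
    (integrableOn_exp_neg_mul_rpow_neg hβ1 (half_pos hz))
    ((ae_restrict_mem measurableSet_Ioi).mono fun x (hx : 0 < x) u hu => ?_)).2
  · rw [norm_mul, norm_neg, Complex.norm_real, Real.norm_of_nonneg (by positivity)]
    gcongr
    exact norm_cexp_neg_mul_le (le_of_lt hu) hx
  · convert! ((hasDerivAt_cexp_neg_mul u x).sub_const (Complex.exp (-w * x))).mul_const
      ((x ^ (-(1 + β)) : ℝ) : ℂ) using 1
    rw [← mul_rpow_neg_one_add hx β]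
    push_cast
    ring

lemma integral_exp_neg_mul_rpow_neg {β r : ℝ} (hβ1 : β < 1) (hr : 0 < r) :
    ∫ x in Ioi (0 : ℝ), Complex.exp (-(r : ℂ) * x) * ((x ^ (-β) : ℝ) : ℂ) =
      Real.Gamma (1 - β) * (r : ℂ) ^ ((β : ℂ) - 1) := by
  have h := Real.integral_rpow_mul_exp_neg_mul_Ioi (a := 1 - β) (by linarith) hr
  have hpow : (1 / r) ^ (1 - β) = r ^ (β - 1) := by
    rw [one_div, Real.inv_rpow hr.le, ← Real.rpow_neg hr.le, neg_sub]
  rw [hpow, mul_comm] at h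
  have hc : ((r ^ (β - 1) : ℝ) : ℂ) = (r : ℂ) ^ ((β : ℂ) - 1) := by
    rw [Complex.ofReal_cpow hr.le]
    push_cast
    rfl
  rw [← hc, ← Complex.ofReal_mul, ← h, ← integral_complex_ofReal]
  refine integral_congr_ae (Filter.Eventually.of_forall fun x => ?_)
  simp only [sub_sub_cancel_left]
  push_cast
  rw [neg_mul, mul_comm]

/-- The half-plane version of `integral_exp_neg_mul_rpow_neg`, by analytic continuation. -/
lemma integral_cexp_neg_mul_rpow_neg {β : ℝ} (hβ1 : β < 1) {z : ℂ} (hz : 0 < z.re) :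
    ∫ x in Ioi (0 : ℝ), -Complex.exp (-z * x) * ((x ^ (-β) : ℝ) : ℂ) =
      -(Real.Gamma (1 - β) * z ^ ((β : ℂ) - 1)) := by
  have hU : IsOpen {u : ℂ | 0 < u.re} := isOpen_lt continuous_const Complex.continuous_re
  have hderiv : ∀ u ∈ {u : ℂ | 0 < u.re}, HasDerivAt _ _ u := fun u (hu : 0 < u.re) =>
    hasDerivAt_integral_cexp_sub_mul_rpow (w := 1) hβ1 hu (by simp)
  have hdiff : DifferentiableOn ℂ
      (fun u : ℂ => ∫ x in Ioi (0 : ℝ), -Complex.exp (-u * x) * ((x ^ (-β) : ℝ) : ℂ))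
      {u : ℂ | 0 < u.re} :=
    (DifferentiableOn.deriv
      (fun u hu => (hderiv u hu).differentiableAt.differentiableWithinAt) hU).congr
      fun u hu => (hderiv u hu).deriv.symm
  have hdiff' : DifferentiableOn ℂ
      (fun u : ℂ => -(Real.Gamma (1 - β) * u ^ ((β : ℂ) - 1))) {u : ℂ | 0 < u.re} :=
    fun u (hu : 0 < u.re) => (((differentiableAt_id.cpow_const (Or.inl hu)).const_mul
      (Real.Gamma (1 - β) : ℂ)).neg).differentiableWithinAt
  refine (hdiff.analyticOnNhd hU).eqOn_of_preconnected_of_frequently_eq (z₀ := 1)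
    (hdiff'.analyticOnNhd hU) (convex_halfSpace_re_gt 0).isPreconnected (by simp) ?_ hz
  have ht : Filter.Tendsto (fun r : ℝ => (r : ℂ)) (nhdsWithin 1 {1}ᶜ) (nhdsWithin 1 {1}ᶜ) := by
    refine tendsto_nhdsWithin_of_tendsto_nhds_of_eventually_within _ ?_ ?_
    · exact (Complex.continuous_ofReal.tendsto' 1 1 (by simp)).mono_left nhdsWithin_le_nhds
    · filter_upwards [self_mem_nhdsWithin] with r hr
      simpa using hr
  refine ht.frequently (Filter.Eventually.frequently ?_)
  filter_upwards [nhdsWithin_le_nhds (Ioi_mem_nhds one_pos)] with r hr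
  simp only [neg_mul, integral_neg, neg_inj]
  simpa only [neg_mul] using integral_exp_neg_mul_rpow_neg hβ1 hr

lemma integral_cexp_sub_mul_rpow {β : ℝ} (hβ0 : 0 < β) (hβ1 : β < 1) {z w : ℂ}
    (hz : 0 < z.re) (hw : 0 < w.re) :
    ∫ x in Ioi (0 : ℝ),
        (Complex.exp (-z * x) - Complex.exp (-w * x)) * ((x ^ (-(1 + β)) : ℝ) : ℂ) =
      Real.Gamma (-β) * (z ^ (β : ℂ) - w ^ (β : ℂ)) := by
  have hU : IsOpen {u : ℂ | 0 < u.re} := isOpen_lt continuous_const Complex.continuous_re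
  have hderiv : ∀ u ∈ {u : ℂ | 0 < u.re}, HasDerivAt _ _ u := fun u (hu : 0 < u.re) =>
    hasDerivAt_integral_cexp_sub_mul_rpow hβ1 hu hw
  have hderiv' : ∀ u ∈ {u : ℂ | 0 < u.re},
      HasDerivAt (fun u : ℂ => (Real.Gamma (-β) : ℂ) * (u ^ (β : ℂ) - w ^ (β : ℂ))) _ u :=
    fun u (hu : 0 < u.re) =>
      (((hasDerivAt_id u).cpow_const (c := (β : ℂ)) (Or.inl hu)).sub_const _).const_mul _
  refine hU.eqOn_of_deriv_eq (convex_halfSpace_re_gt 0).isPreconnected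
    (fun u hu => (hderiv u hu).differentiableAt.differentiableWithinAt)
    (fun u hu => (hderiv' u hu).differentiableAt.differentiableWithinAt)
    (fun u hu => ?_) (x := w) hw (by simp) hz
  rw [(hderiv u hu).deriv, (hderiv' u hu).deriv, integral_cexp_neg_mul_rpow_neg hβ1 hu,
    show 1 - β = -β + 1 by ring, Real.Gamma_add_one (neg_ne_zero.mpr hβ0.ne')]
  push_cast
  simp only [id_eq]
  ring

/-- For `0 < β < 1`, `λ > 0`, `α ≥ 0` and `ξ ∈ ℝ`, the function
`x ↦ (e^{iξx} − 1) · α · e^{−λx} · x^{−(1+β)}` is integrable on `(0, ∞)` and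
`∫_0^∞ (e^{iξx} − 1) α e^{−λx} x^{−(1+β)} dx = α Γ(−β) ((λ − iξ)^β − λ^β)`,
with `Γ` the (extended) Gamma function and principal-branch complex powers. -/
theorem gts_positive_side_characteristic_integral
    (β lam α ξ : ℝ) (hβ0 : 0 < β) (hβ1 : β < 1) (hlam : 0 < lam) (hα : 0 ≤ α) :
    IntegrableOn
      (fun x : ℝ => (Complex.exp (Complex.I * ξ * x) - 1) * (α : ℂ) *
        (Real.exp (-lam * x) : ℝ) * ((x ^ (-(1 + β)) : ℝ) : ℂ))
      (Ioi (0 : ℝ)) ∧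
    ∫ x in Ioi (0 : ℝ),
        (Complex.exp (Complex.I * ξ * x) - 1) * (α : ℂ) *
          (Real.exp (-lam * x) : ℝ) * ((x ^ (-(1 + β)) : ℝ) : ℂ)
      = (α : ℂ) * (Real.Gamma (-β) : ℝ) *
          (((lam : ℂ) - Complex.I * ξ) ^ (β : ℂ) - (lam : ℂ) ^ (β : ℂ)) := by
  have hz : 0 < ((lam : ℂ) - Complex.I * ξ).re := by simpa using hlam
  have hw : 0 < (lam : ℂ).re := by simpa using hlam
  have heq : (fun x : ℝ => (Complex.exp (Complex.I * ξ * x) - 1) * (α : ℂ) *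
      (Real.exp (-lam * x) : ℝ) * ((x ^ (-(1 + β)) : ℝ) : ℂ)) =
      fun x : ℝ => (α : ℂ) * ((Complex.exp (-((lam : ℂ) - Complex.I * ξ) * x) -
        Complex.exp (-(lam : ℂ) * x)) * ((x ^ (-(1 + β)) : ℝ) : ℂ)) := by
    funext x
    rw [show -((lam : ℂ) - Complex.I * ξ) * x = Complex.I * ξ * x + -(lam : ℂ) * x by ring,
      Complex.exp_add, Complex.ofReal_exp, Complex.ofReal_mul, Complex.ofReal_neg]
    ring
  rw [heq]
  refine ⟨(integrableOn_cexp_sub_mul_rpow hβ1 hz hw).const_mul _, ?_⟩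
  rw [integral_const_mul, integral_cexp_sub_mul_rpow hβ0 hβ1 hz hw, mul_assoc]
end

section
/- Let 0 < β < 1, λ > 0, α ≥ 0, and ξ ∈ ℝ. Then the function x ↦ (e^{iξx} − 1) · α · e^{−λ|x|} · |x|^{−(1+β)} is (Lebesgue) integrable on (−∞, 0), and ∫_{−∞}^0 (e^{iξx} − 1) · α · e^{−λ|x|} · |x|^{−(1+β)} dx = α · Γ(−β) · ((λ + iξ)^β − λ^β), where Γ is the Gamma function (evaluated at the negative real number −β via its standard extension) and the complex power z^β is taken with the principal branch. -/
open MeasureTheory Set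

open scoped Topology

namespace TemperedStable

/-- The open right half-plane. -/
def rightHalfPlane : Set ℂ := {z | 0 < z.re}

lemma isOpen_rightHalfPlane : IsOpen rightHalfPlane :=
  isOpen_lt continuous_const Complex.continuous_re

lemma isPreconnected_rightHalfPlane : IsPreconnected rightHalfPlane :=
  (convex_halfSpace_re_gt 0).isPreconnected

lemma norm_exp_neg_mul_le {m t : ℝ} {z : ℂ} (ht : 0 ≤ t) (hz : m ≤ z.re) :
    ‖Complex.exp (-z * t)‖ ≤ Real.exp (-m * t) := by
  rw [Complex.norm_exp]
  simp only [Complex.mul_re, Complex.neg_re, Complex.ofReal_re, Complex.ofReal_im, mul_zero,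
    sub_zero, Real.exp_le_exp]
  nlinarith

lemma hasDerivAt_exp_neg_mul (z t : ℂ) :
    HasDerivAt (fun w : ℂ => Complex.exp (-w * t)) (-t * Complex.exp (-z * t)) z := by
  have h : HasDerivAt (fun w : ℂ => -w * t) (-1 * t) z := (hasDerivAt_id z).neg.mul_const t
  simpa [mul_comm] using h.cexp

lemma norm_exp_neg_mul_sub_le {m t : ℝ} {z w : ℂ} (ht : 0 ≤ t) (hz : m ≤ z.re) (hw : m ≤ w.re) :
    ‖Complex.exp (-z * t) - Complex.exp (-w * t)‖ ≤ t * Real.exp (-m * t) * ‖z - w‖ := by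
  refine (convex_halfSpace_re_ge m).norm_image_sub_le_of_norm_hasDerivWithin_le
    (fun x _ => (hasDerivAt_exp_neg_mul x t).hasDerivWithinAt) (fun x hx => ?_) hw hz
  rw [norm_mul, norm_neg, Complex.norm_of_nonneg ht]
  exact mul_le_mul_of_nonneg_left (norm_exp_neg_mul_le ht hx) ht

lemma mul_rpow_neg_one_add {t : ℝ} (ht : 0 < t) (β : ℝ) : t * t ^ (-(1 + β)) = t ^ (-β) := by
  nth_rewrite 1 [← Real.rpow_one t]
  rw [← Real.rpow_add ht]
  ring_nf

lemma integrableOn_rpow_neg_mul_exp {β m : ℝ} (hβ : β < 1) (hm : 0 < m) :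
    IntegrableOn (fun t : ℝ => t ^ (-β) * Real.exp (-m * t)) (Ioi 0) := by
  simpa using integrableOn_rpow_mul_exp_neg_mul_rpow (s := -β) (by linarith) one_pos hm

/-- The difference of two exponentials against the singular weight `t ^ (-(1 + β))`. -/
noncomputable def expDiffKernel (β : ℝ) (w z : ℂ) (t : ℝ) : ℂ :=
  (Complex.exp (-z * t) - Complex.exp (-w * t)) * ((t ^ (-(1 + β)) : ℝ) : ℂ)

lemma measurable_expDiffKernel (β : ℝ) (w z : ℂ) : Measurable (expDiffKernel β w z) := by
  unfold expDiffKernel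
  fun_prop

lemma integrableOn_expDiffKernel {β : ℝ} (hβ : β < 1) {w z : ℂ} (hw : 0 < w.re) (hz : 0 < z.re) :
    IntegrableOn (expDiffKernel β w z) (Ioi 0) := by
  have hm : 0 < min z.re w.re := lt_min hz hw
  refine Integrable.mono' ((integrableOn_rpow_neg_mul_exp hβ hm).mul_const ‖z - w‖)
    (measurable_expDiffKernel β w z).aestronglyMeasurable ?_
  filter_upwards [ae_restrict_mem measurableSet_Ioi] with t (ht : 0 < t)
  have h := norm_exp_neg_mul_sub_le ht.le (min_le_left z.re w.re) (min_le_right z.re w.re)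
  have hp : 0 ≤ t ^ (-(1 + β)) := Real.rpow_nonneg ht.le _
  rw [expDiffKernel, norm_mul, Complex.norm_of_nonneg hp, ← mul_rpow_neg_one_add ht β]
  calc _ ≤ t * Real.exp (-min z.re w.re * t) * ‖z - w‖ * t ^ (-(1 + β)) :=
        mul_le_mul_of_nonneg_right h hp
    _ = _ := by ring

lemma hasDerivAt_integral_expDiffKernel {β : ℝ} (hβ : β < 1) {w z : ℂ} (hw : 0 < w.re)
    (hz : 0 < z.re) :
    HasDerivAt (fun z => ∫ t in Ioi (0 : ℝ), expDiffKernel β w z t)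
      (∫ t in Ioi (0 : ℝ), -(t : ℂ) * Complex.exp (-z * t) * ((t ^ (-(1 + β)) : ℝ) : ℂ)) z := by
  have hm : 0 < z.re / 2 := half_pos hz
  have hs : {u : ℂ | z.re / 2 < u.re} ∈ 𝓝 z :=
    (isOpen_lt continuous_const Complex.continuous_re).mem_nhds (half_lt_self hz)
  refine (hasDerivAt_integral_of_dominated_loc_of_deriv_le
    (bound := fun t => t ^ (-β) * Real.exp (-(z.re / 2) * t))
    (F' := fun z t => -(t : ℂ) * Complex.exp (-z * t) * ((t ^ (-(1 + β)) : ℝ) : ℂ)) hs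
    (.of_forall fun u => (measurable_expDiffKernel β w u).aestronglyMeasurable)
    (integrableOn_expDiffKernel hβ hw hz) ?_ ?_ (integrableOn_rpow_neg_mul_exp hβ hm) ?_).2
  · exact Measurable.aestronglyMeasurable (by fun_prop)
  · filter_upwards [ae_restrict_mem measurableSet_Ioi] with t (ht : 0 < t) u hu
    have h := norm_exp_neg_mul_le ht.le (le_of_lt hu)
    have hp : 0 ≤ t ^ (-(1 + β)) := Real.rpow_nonneg ht.le _
    rw [norm_mul, norm_mul, norm_neg, Complex.norm_of_nonneg hp, Complex.norm_of_nonneg ht.le,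
      ← mul_rpow_neg_one_add ht β]
    calc _ ≤ t * Real.exp (-(z.re / 2) * t) * t ^ (-(1 + β)) := by gcongr
      _ = _ := by ring
  · exact .of_forall fun t u _ => ((hasDerivAt_exp_neg_mul u t).sub_const _).mul_const _

lemma deriv_integral_expDiffKernel_ofReal {β : ℝ} (hβ0 : 0 < β) (hβ : β < 1) {w : ℂ}
    (hw : 0 < w.re) {r : ℝ} (hr : 0 < r) :
    deriv (fun z => ∫ t in Ioi (0 : ℝ), expDiffKernel β w z t) r =
      (Real.Gamma (-β) : ℂ) * (β * (r : ℂ) ^ ((β : ℂ) - 1)) := by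
  have h := (hasDerivAt_integral_expDiffKernel hβ hw (z := r) (by simpa using hr)).deriv
  rw [h]
  have hi := Real.integral_rpow_mul_exp_neg_mul_Ioi (a := 1 - β) (by linarith) hr
  have hG : Real.Gamma (1 - β) = -β * Real.Gamma (-β) := by
    rw [← Real.Gamma_add_one (by linarith)]
    ring_nf
  have hpow : (1 / r) ^ (1 - β) = r ^ (β - 1) := by
    rw [one_div, Real.inv_rpow hr.le, ← Real.rpow_neg hr.le]
    ring_nf
  rw [hG, hpow] at hi
  have hcongr : (∫ t in Ioi (0 : ℝ), -(t : ℂ) * Complex.exp (-(r : ℂ) * t) *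
      ((t ^ (-(1 + β)) : ℝ) : ℂ)) =
      ∫ t in Ioi (0 : ℝ), ((-(t ^ (1 - β - 1) * Real.exp (-(r * t))) : ℝ) : ℂ) := by
    refine setIntegral_congr_fun measurableSet_Ioi fun t (ht : 0 < t) => ?_
    rw [show 1 - β - 1 = -β by ring, ← mul_rpow_neg_one_add ht β]
    push_cast
    ring_nf
  rw [hcongr, integral_complex_ofReal, integral_neg, hi]
  have hc : (r : ℂ) ^ ((β : ℂ) - 1) = ((r ^ (β - 1) : ℝ) : ℂ) := by
    rw [Complex.ofReal_cpow hr.le]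
    push_cast
    rfl
  rw [hc]
  push_cast
  ring

lemma hasDerivAt_cpow_sub {β : ℝ} {w z : ℂ} (hz : 0 < z.re) :
    HasDerivAt (fun z : ℂ => (Real.Gamma (-β) : ℂ) * (z ^ (β : ℂ) - w ^ (β : ℂ)))
      ((Real.Gamma (-β) : ℂ) * (β * z ^ ((β : ℂ) - 1))) z := by
  have h := (hasDerivAt_id z).cpow_const (c := (β : ℂ)) (.inl hz)
  simpa using (h.sub_const (w ^ (β : ℂ))).const_mul (Real.Gamma (-β) : ℂ)

lemma eqOn_deriv_integral_expDiffKernel {β : ℝ} (hβ0 : 0 < β) (hβ : β < 1) {w : ℂ}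
    (hw : 0 < w.re) :
    EqOn (deriv fun z => ∫ t in Ioi (0 : ℝ), expDiffKernel β w z t)
      (deriv fun z : ℂ => (Real.Gamma (-β) : ℂ) * (z ^ (β : ℂ) - w ^ (β : ℂ)))
      rightHalfPlane := by
  have hF : DifferentiableOn ℂ (fun z => ∫ t in Ioi (0 : ℝ), expDiffKernel β w z t)
      rightHalfPlane := fun z hz =>
    (hasDerivAt_integral_expDiffKernel hβ hw hz).differentiableAt.differentiableWithinAt
  have hG : DifferentiableOn ℂ
      (fun z : ℂ => (Real.Gamma (-β) : ℂ) * (z ^ (β : ℂ) - w ^ (β : ℂ)))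
      rightHalfPlane := fun z hz =>
    (hasDerivAt_cpow_sub hz).differentiableAt.differentiableWithinAt
  refine ((hF.analyticOnNhd isOpen_rightHalfPlane).deriv).eqOn_of_preconnected_of_frequently_eq
    ((hG.analyticOnNhd isOpen_rightHalfPlane).deriv) isPreconnected_rightHalfPlane
    (z₀ := ((1 : ℝ) : ℂ)) (by simp [rightHalfPlane]) ?_
  have htend : Filter.Tendsto (fun r : ℝ => (r : ℂ)) (𝓝[>] 1) (𝓝[≠] ((1 : ℝ) : ℂ)) := by
    refine tendsto_nhdsWithin_iff.2 ⟨Complex.continuous_ofReal.continuousAt.mono_left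
      nhdsWithin_le_nhds, ?_⟩
    filter_upwards [self_mem_nhdsWithin] with r (hr : 1 < r)
    simpa using hr.ne'
  refine htend.frequently (Filter.Eventually.frequently ?_)
  filter_upwards [self_mem_nhdsWithin] with r (hr : 1 < r)
  have hr0 : 0 < r := one_pos.trans hr
  rw [deriv_integral_expDiffKernel_ofReal hβ0 hβ hw hr0,
    (hasDerivAt_cpow_sub (by simpa using hr0)).deriv]

theorem integral_expDiffKernel {β : ℝ} (hβ0 : 0 < β) (hβ : β < 1) {w z : ℂ}
    (hw : 0 < w.re) (hz : 0 < z.re) :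
    ∫ t in Ioi (0 : ℝ), expDiffKernel β w z t =
      (Real.Gamma (-β) : ℂ) * (z ^ (β : ℂ) - w ^ (β : ℂ)) := by
  refine isOpen_rightHalfPlane.eqOn_of_deriv_eq isPreconnected_rightHalfPlane
    (fun z hz =>
      (hasDerivAt_integral_expDiffKernel hβ hw hz).differentiableAt.differentiableWithinAt)
    (fun z hz => (hasDerivAt_cpow_sub hz).differentiableAt.differentiableWithinAt)
    (eqOn_deriv_integral_expDiffKernel hβ0 hβ hw) (x := w) hw ?_ hz
  simp [expDiffKernel]

end TemperedStable

/-- For `0 < β < 1`, `λ > 0`, `α ≥ 0` and `ξ ∈ ℝ`, the function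
`x ↦ (e^{iξx} − 1) · α · e^{−λ|x|} · |x|^{−(1+β)}` is integrable on `(−∞, 0)` and
`∫_{−∞}^0 (e^{iξx} − 1) α e^{−λ|x|} |x|^{−(1+β)} dx = α Γ(−β) ((λ + iξ)^β − λ^β)`,
with `Γ` the (extended) Gamma function and principal-branch complex powers. -/
theorem gts_negative_side_characteristic_integral
    (β lam α ξ : ℝ) (hβ0 : 0 < β) (hβ1 : β < 1) (hlam : 0 < lam) (hα : 0 ≤ α) :
    IntegrableOn
      (fun x : ℝ => (Complex.exp (Complex.I * ξ * x) - 1) * (α : ℂ) *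
        (Real.exp (-lam * |x|) : ℝ) * ((|x| ^ (-(1 + β)) : ℝ) : ℂ))
      (Iio (0 : ℝ)) ∧
    ∫ x in Iio (0 : ℝ),
        (Complex.exp (Complex.I * ξ * x) - 1) * (α : ℂ) *
          (Real.exp (-lam * |x|) : ℝ) * ((|x| ^ (-(1 + β)) : ℝ) : ℂ)
      = (α : ℂ) * (Real.Gamma (-β) : ℝ) *
          (((lam : ℂ) + Complex.I * ξ) ^ (β : ℂ) - (lam : ℂ) ^ (β : ℂ)) := by
  have hre : 0 < ((lam : ℂ) + Complex.I * ξ).re := by simpa using hlam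
  have hlam' : 0 < (lam : ℂ).re := by simpa using hlam
  set f : ℝ → ℂ := fun x => (Complex.exp (Complex.I * ξ * x) - 1) * (α : ℂ) *
    (Real.exp (-lam * |x|) : ℝ) * ((|x| ^ (-(1 + β)) : ℝ) : ℂ) with hf
  set k := TemperedStable.expDiffKernel β lam (lam + Complex.I * ξ) with hk
  have hfk : EqOn (fun t => f (-t)) (fun t => (α : ℂ) * k t) (Ioi 0) := by
    intro t (ht : 0 < t)
    have hexp : Complex.exp (-((lam : ℂ) + Complex.I * ξ) * t) =
        Complex.exp (Complex.I * ξ * (-t)) * Complex.exp (-lam * t) := by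
      rw [← Complex.exp_add]
      ring_nf
    simp only [hf, hk, TemperedStable.expDiffKernel, abs_neg, abs_of_pos ht, hexp]
    push_cast
    ring
  have hkint : IntegrableOn (fun t => f (-t)) (Ioi 0) :=
    IntegrableOn.congr_fun
      ((TemperedStable.integrableOn_expDiffKernel hβ1 hlam' hre).const_mul (α : ℂ))
      hfk.symm measurableSet_Ioi
  refine ⟨?_, ?_⟩
  · have h : IntegrableOn (fun t => f (-t)) (Ioi (-0)) := by simpa using hkint
    simpa using h.comp_neg_Iio
  · calc ∫ x in Iio (0 : ℝ), f x = ∫ x in Iic (-0 : ℝ), f x := by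
          rw [neg_zero, integral_Iic_eq_integral_Iio]
      _ = ∫ t in Ioi (0 : ℝ), f (-t) := (integral_comp_neg_Ioi 0 f).symm
      _ = ∫ t in Ioi (0 : ℝ), (α : ℂ) * k t := setIntegral_congr_fun measurableSet_Ioi hfk
      _ = _ := by
          rw [integral_const_mul, hk, TemperedStable.integral_expDiffKernel hβ0 hβ1 hlam' hre,
            mul_assoc]
end

section
/- Let 0 < β₊ < 1, 0 < β₋ < 1, λ₊ > 0, λ₋ > 0, α₊ ≥ 0, α₋ ≥ 0, μ ∈ ℝ, and ξ ∈ ℝ. Define the GTS Lévy density v(x) = α₊ · e^{−λ₊x} · x^{−(1+β₊)} for x > 0 and v(x) = α₋ · e^{−λ₋|x|} · |x|^{−(1+β₋)} for x < 0. Then x ↦ (e^{iξx} − 1) · v(x) is integrable on ℝ\{0}, and the characteristic exponent ψ(ξ) = iμξ + ∫_{ℝ\{0}} (e^{iξx} − 1) · v(x) dx satisfies ψ(ξ) = iμξ + α₊ · Γ(−β₊) · ((λ₊ − iξ)^{β₊} − λ₊^{β₊}) + α₋ · Γ(−β₋) · ((λ₋ + iξ)^{β₋} − λ₋^{β₋}),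 where complex powers use the principal branch. -/
open MeasureTheory Set

lemma integrableOn_rpow_mul_exp_neg_mul {s r : ℝ} (hs : 0 < s) (hr : 0 < r) :
    IntegrableOn (fun x : ℝ ↦ x ^ (s - 1) * Real.exp (-r * x)) (Ioi 0) := by
  simpa using integrableOn_rpow_mul_exp_neg_mul_rpow (p := 1) (s := s - 1) (by linarith) one_pos hr

lemma integrableOn_rpow_mul_cexp_neg_mul {s : ℝ} {z : ℂ} (hs : 0 < s) (hz : 0 < z.re) :
    IntegrableOn (fun x : ℝ ↦ ((x ^ (s - 1) : ℝ) : ℂ) * Complex.exp (-z * x)) (Ioi 0) := by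
  refine (integrableOn_rpow_mul_exp_neg_mul hs hz).mono' (by fun_prop) ?_
  filter_upwards [ae_restrict_mem measurableSet_Ioi] with x hx
  have hx : 0 < x := hx
  rw [norm_mul, Complex.norm_exp, Complex.norm_real, Real.norm_of_nonneg (by positivity)]
  simp

/-- Euler's integral for the Gamma function with a complex rate `z` in the right half plane. -/
lemma integral_rpow_mul_cexp_neg_mul {s : ℝ} {z : ℂ} (hs : 0 < s) (hz : 0 < z.re) :
    ∫ x in Ioi (0 : ℝ), ((x ^ (s - 1) : ℝ) : ℂ) * Complex.exp (-z * x)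
      = (Real.Gamma s : ℂ) * z ^ (-s : ℂ) := by
  set ν : Measure ℝ := (volume.restrict (Ioi 0)).withDensity
    (fun x ↦ ((x ^ (s - 1)).toNNReal : ENNReal)) with hν
  have hmeas : Measurable fun x : ℝ ↦ (x ^ (s - 1)).toNNReal := by fun_prop
  have hG (w : ℂ) : ProbabilityTheory.complexMGF id ν w
      = ∫ x in Ioi (0 : ℝ), ((x ^ (s - 1) : ℝ) : ℂ) * Complex.exp (w * x) := by
    rw [ProbabilityTheory.complexMGF, hν, integral_withDensity_eq_integral_smul hmeas]
    refine setIntegral_congr_fun measurableSet_Ioi fun x hx ↦ ?_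
    have hx : 0 < x := hx
    simp [NNReal.smul_def, Real.coe_toNNReal _ (Real.rpow_nonneg hx.le (s - 1))]
  have hset : Iio 0 ⊆ interior (ProbabilityTheory.integrableExpSet id ν) := by
    refine interior_maximal (fun t ht ↦ ?_) isOpen_Iio
    have ht : t < 0 := ht
    change Integrable _ ν
    rw [hν, integrable_withDensity_iff_integrable_smul hmeas]
    refine (integrableOn_rpow_mul_exp_neg_mul hs (neg_pos.2 ht)).congr_fun (fun x hx ↦ ?_)
      measurableSet_Ioi
    have hx : 0 < x := hx
    simp [NNReal.smul_def, Real.coe_toNNReal _ (Real.rpow_nonneg hx.le (s - 1))]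
  have hU : IsOpen {w : ℂ | w.re < 0} := isOpen_lt Complex.continuous_re continuous_const
  have hA : AnalyticOnNhd ℂ (ProbabilityTheory.complexMGF id ν) {w : ℂ | w.re < 0} :=
    ProbabilityTheory.analyticOnNhd_complexMGF.mono fun w hw ↦ hset hw
  have hB : AnalyticOnNhd ℂ (fun w : ℂ ↦ (Real.Gamma s : ℂ) * (-w) ^ (-s : ℂ))
      {w : ℂ | w.re < 0} := by
    refine DifferentiableOn.analyticOnNhd (fun w hw ↦ ?_) hU
    have hw : w.re < 0 := hw
    refine DifferentiableAt.differentiableWithinAt ?_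
    refine (DifferentiableAt.cpow_const (by fun_prop) (Or.inl ?_)).const_mul _
    simpa using hw
  have hreal (r : ℝ) (hr : 0 < r) : ProbabilityTheory.complexMGF id ν (-r)
      = (Real.Gamma s : ℂ) * (-(-r : ℂ)) ^ (-s : ℂ) := by
    rw [hG, neg_neg]
    have h := Real.integral_rpow_mul_exp_neg_mul_Ioi hs hr
    rw [one_div, Real.inv_rpow hr.le, ← Real.rpow_neg hr.le, mul_comm] at h
    have h' := congrArg (fun t : ℝ ↦ (t : ℂ)) h
    simp only [Complex.ofReal_mul, Complex.ofReal_cpow hr.le, ← integral_complex_ofReal] at h'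
    push_cast at h'
    rw [← h']
    simp
  have hEq := hA.eqOn_of_preconnected_of_frequently_eq hB
    (convex_halfSpace_re_lt 0).isPreconnected (z₀ := -1) (by simp) ?_
  · have := hEq (x := -z) (by simpa using hz)
    simpa only [hG, neg_neg] using this
  · have ht : Filter.Tendsto (fun r : ℝ ↦ (-r : ℂ)) (nhdsWithin 1 (Ioi 1))
        (nhdsWithin (-1) {-1}ᶜ) := by
      refine tendsto_nhdsWithin_iff.2 ⟨?_, ?_⟩
      · refine Filter.Tendsto.mono_left ?_ nhdsWithin_le_nhds
        have : Continuous fun r : ℝ ↦ (-r : ℂ) := by fun_prop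
        simpa using this.tendsto 1
      · filter_upwards [self_mem_nhdsWithin] with r hr
        have hr : 1 < r := hr
        simp only [mem_compl_iff, mem_singleton_iff, neg_inj]
        exact_mod_cast hr.ne'
    refine ht.frequently (Filter.Eventually.frequently ?_)
    filter_upwards [self_mem_nhdsWithin] with r hr
    exact hreal r (zero_lt_one.trans hr)

lemma norm_exp_sub_one_mul_exp_le (ξ l x : ℝ) :
    ‖(Complex.exp (Complex.I * ξ * x) - 1) * (Real.exp (-l * x) : ℂ)‖
      ≤ |ξ| * (|x| * Real.exp (-l * x)) := by
  rw [norm_mul, Complex.norm_real, Real.norm_of_nonneg (Real.exp_pos _).le, ← mul_assoc]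
  gcongr
  have := Real.norm_exp_I_mul_ofReal_sub_one_le (x := ξ * x)
  simpa [mul_assoc] using this

lemma integrableOn_temperedStable {β l : ℝ} (hβ : β < 1) (hl : 0 < l) (ξ : ℝ) :
    IntegrableOn (fun x : ℝ ↦ (Complex.exp (Complex.I * ξ * x) - 1) *
      ((Real.exp (-l * x) * x ^ (-(1 + β)) : ℝ) : ℂ)) (Ioi 0) := by
  refine ((integrableOn_rpow_mul_exp_neg_mul (s := 1 - β) (by linarith) hl).const_mul |ξ|).mono'
    (by fun_prop) ?_
  filter_upwards [ae_restrict_mem measurableSet_Ioi] with x hx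
  have hx : 0 < x := hx
  rw [Complex.ofReal_mul, ← mul_assoc, norm_mul, Complex.norm_real,
    Real.norm_of_nonneg (Real.rpow_nonneg hx.le _)]
  calc _ ≤ |ξ| * (|x| * Real.exp (-l * x)) * x ^ (-(1 + β)) := by
        gcongr; exact norm_exp_sub_one_mul_exp_le ξ l x
    _ = _ := by
        rw [abs_of_pos hx, show 1 - β - 1 = 1 + -(1 + β) by ring, Real.rpow_add hx, Real.rpow_one]
        ring

open Filter Topology in
/-- The characteristic exponent of the one-sided tempered stable Lévy density. -/
lemma integral_temperedStable {β l : ℝ} (hβ0 : 0 < β) (hβ : β < 1) (hl : 0 < l) (ξ : ℝ) :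
    ∫ x in Ioi (0 : ℝ), (Complex.exp (Complex.I * ξ * x) - 1) *
      ((Real.exp (-l * x) * x ^ (-(1 + β)) : ℝ) : ℂ)
      = (Real.Gamma (-β) : ℂ) * (((l : ℂ) - Complex.I * ξ) ^ (β : ℂ) - (l : ℂ) ^ (β : ℂ)) := by
  set z : ℂ := (l : ℂ) - Complex.I * ξ with hz
  have hzre : 0 < z.re := by simpa [hz] using hl
  have hlre : 0 < (l : ℂ).re := by simpa using hl
  have hβC : (β : ℂ) ≠ 0 := by exact_mod_cast hβ0.ne'
  have hs : 0 < 1 - β := by linarith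
  set u : ℝ → ℂ := fun x ↦ Complex.exp (-z * x) - Complex.exp (-(l : ℂ) * x) with hu
  have hu_eq (x : ℝ) : u x = (Complex.exp (Complex.I * ξ * x) - 1) * (Real.exp (-l * x) : ℂ) := by
    simp only [hu, hz]
    push_cast
    rw [sub_mul, ← Complex.exp_add, one_mul]
    ring_nf
  set v : ℝ → ℂ := fun x ↦ ((-(x ^ (-β) / β) : ℝ) : ℂ) with hv
  have hu' (x : ℝ) : HasDerivAt u
      (-z * Complex.exp (-z * x) - -(l : ℂ) * Complex.exp (-(l : ℂ) * x)) x := by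
    have h (w : ℂ) : HasDerivAt (fun x : ℝ ↦ Complex.exp (w * x)) (w * Complex.exp (w * x)) x := by
      have := ((hasDerivAt_id (x : ℂ)).const_mul w).cexp.comp_ofReal
      simpa [mul_comm] using this
    exact (h _).sub (h _)
  have hv' (x : ℝ) (hx : x ∈ Ioi (0 : ℝ)) : HasDerivAt v ((x ^ (-(1 + β)) : ℝ) : ℂ) x := by
    have hx : 0 < x := hx
    refine HasDerivAt.ofReal_comp ?_
    refine ((Real.hasDerivAt_rpow_const (Or.inl hx.ne')).div_const β).neg.congr_deriv ?_
    rw [show -β - 1 = -(1 + β) by ring]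
    field_simp
  have hbound (x : ℝ) (hx : 0 < x) :
      ‖(u * v) x‖ ≤ |ξ| / β * (x ^ (1 - β) * Real.exp (-l * x)) := by
    have hvn : ‖v x‖ = x ^ (-β) / β := by
      rw [hv, Complex.norm_real, norm_neg, Real.norm_of_nonneg (by positivity)]
    rw [Pi.mul_apply, norm_mul, hvn, hu_eq]
    calc _ ≤ |ξ| * (|x| * Real.exp (-l * x)) * (x ^ (-β) / β) := by
          gcongr; exact norm_exp_sub_one_mul_exp_le ξ l x
      _ = _ := by
          rw [abs_of_pos hx, sub_eq_add_neg, Real.rpow_add hx, Real.rpow_one]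
          ring
  have h_zero : Tendsto (u * v) (𝓝[>] 0) (𝓝 0) := by
    refine squeeze_zero_norm' (eventually_mem_nhdsWithin.mono hbound) ?_
    have hc : Continuous fun x : ℝ ↦ |ξ| / β * (x ^ (1 - β) * Real.exp (-l * x)) := by
      have := Real.continuous_rpow_const hs.le
      fun_prop
    have := hc.tendsto 0
    rw [Real.zero_rpow hs.ne', zero_mul, mul_zero] at this
    exact this.mono_left nhdsWithin_le_nhds
  have h_infty : Tendsto (u * v) atTop (𝓝 0) := by
    refine squeeze_zero_norm' ((eventually_gt_atTop 0).mono hbound) ?_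
    simpa using (tendsto_rpow_mul_exp_neg_mul_atTop_nhds_zero (1 - β) l hl).const_mul (|ξ| / β)
  have hcomb : (fun x : ℝ ↦
      (-z * Complex.exp (-z * x) - -(l : ℂ) * Complex.exp (-(l : ℂ) * x)) * v x)
      = fun x ↦ (z / β) * (((x ^ (1 - β - 1) : ℝ) : ℂ) * Complex.exp (-z * x))
        - (l / β) * (((x ^ (1 - β - 1) : ℝ) : ℂ) * Complex.exp (-(l : ℂ) * x)) := by
    ext x
    rw [hv, show 1 - β - 1 = -β by ring]
    push_cast
    field_simp
    ring
  have hI1 := (integrableOn_rpow_mul_cexp_neg_mul hs hzre).const_mul (z / β)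
  have hI2 := (integrableOn_rpow_mul_cexp_neg_mul hs hlre).const_mul ((l : ℂ) / β)
  have hcongr : (fun x : ℝ ↦ (Complex.exp (Complex.I * ξ * x) - 1) *
      ((Real.exp (-l * x) * x ^ (-(1 + β)) : ℝ) : ℂ))
      = fun x ↦ u x * ((x ^ (-(1 + β)) : ℝ) : ℂ) := by
    ext x
    rw [hu_eq, Complex.ofReal_mul, ← mul_assoc]
  have hint := integrableOn_temperedStable hβ hl ξ
  rw [hcongr] at hint ⊢
  rw [integral_Ioi_mul_deriv_eq_deriv_mul (fun x _ ↦ hu' x) hv' hint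
    (by rw [Pi.mul_def, hcomb]; exact hI1.sub hI2) h_zero h_infty, hcomb,
    integral_sub hI1 hI2, integral_const_mul, integral_const_mul,
    integral_rpow_mul_cexp_neg_mul hs hzre, integral_rpow_mul_cexp_neg_mul hs hlre]
  have hΓ : (Real.Gamma (1 - β) : ℂ) = -β * Real.Gamma (-β) := by
    have := Real.Gamma_add_one (neg_ne_zero.2 hβ0.ne')
    rw [show 1 - β = -β + 1 by ring, this]
    push_cast
    rfl
  have hpow (w : ℂ) (hw : 0 < w.re) : w * w ^ (-((1 - β : ℝ) : ℂ)) = w ^ (β : ℂ) := by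
    have hw0 : w ≠ 0 := by rintro rfl; simp at hw
    nth_rewrite 1 [← Complex.cpow_one w]
    rw [← Complex.cpow_add _ _ hw0]
    congr 1
    push_cast
    ring
  rw [hΓ, ← hpow z hzre, ← hpow l hlre]
  field_simp
  ring

/-- For `0 < β₊, β₋ < 1`, `λ₊, λ₋ > 0`, `α₊, α₋ ≥ 0`, `μ ∈ ℝ`, `ξ ∈ ℝ`,
with the GTS Lévy density `v`, the function `x ↦ (e^{iξx} − 1) v(x)` is integrable on
`ℝ\{0}` and the characteristic exponent `ψ(ξ) = iμξ + ∫_{ℝ\{0}} (e^{iξx} − 1) v(x) dx`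
equals `iμξ + α₊ Γ(−β₊)((λ₊ − iξ)^{β₊} − λ₊^{β₊}) + α₋ Γ(−β₋)((λ₋ + iξ)^{β₋} − λ₋^{β₋})`. -/
theorem gts_characteristic_exponent
    (βp βm lamp lamm αp αm μ ξ : ℝ)
    (hβp0 : 0 < βp) (hβp1 : βp < 1) (hβm0 : 0 < βm) (hβm1 : βm < 1)
    (hlamp : 0 < lamp) (hlamm : 0 < lamm)
    (hαp : 0 ≤ αp) (hαm : 0 ≤ αm)
    (v : ℝ → ℝ)
    (hvp : ∀ x : ℝ, 0 < x → v x = αp * Real.exp (-lamp * x) * x ^ (-(1 + βp)))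
    (hvm : ∀ x : ℝ, x < 0 → v x = αm * Real.exp (-lamm * |x|) * |x| ^ (-(1 + βm))) :
    IntegrableOn
      (fun x : ℝ => (Complex.exp (Complex.I * ξ * x) - 1) * ((v x : ℝ) : ℂ))
      ({0}ᶜ : Set ℝ) ∧
    Complex.I * μ * ξ +
        ∫ x in ({0}ᶜ : Set ℝ), (Complex.exp (Complex.I * ξ * x) - 1) * ((v x : ℝ) : ℂ)
      = Complex.I * μ * ξ +
        (αp : ℂ) * (Real.Gamma (-βp) : ℝ) *
          (((lamp : ℂ) - Complex.I * ξ) ^ (βp : ℂ) - (lamp : ℂ) ^ (βp : ℂ)) +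
        (αm : ℂ) * (Real.Gamma (-βm) : ℝ) *
          (((lamm : ℂ) + Complex.I * ξ) ^ (βm : ℂ) - (lamm : ℂ) ^ (βm : ℂ)) := by
  set f : ℝ → ℂ := fun x ↦ (Complex.exp (Complex.I * ξ * x) - 1) * ((v x : ℝ) : ℂ) with hf
  have hpos : EqOn (fun x : ℝ ↦ (αp : ℂ) * ((Complex.exp (Complex.I * ξ * x) - 1) *
      ((Real.exp (-lamp * x) * x ^ (-(1 + βp)) : ℝ) : ℂ))) f (Ioi 0) := fun x hx ↦ by
    simp only [hf, hvp x hx]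
    push_cast
    ring
  have hneg : EqOn (fun x : ℝ ↦ (αm : ℂ) * ((Complex.exp (Complex.I * (-ξ : ℝ) * x) - 1) *
      ((Real.exp (-lamm * x) * x ^ (-(1 + βm)) : ℝ) : ℂ))) (fun x ↦ f (-x)) (Ioi 0) :=
    fun x hx ↦ by
      have hx : 0 < x := hx
      simp only [hf, hvm (-x) (neg_lt_zero.2 hx), abs_neg, abs_of_pos hx]
      push_cast
      ring_nf
  have hIp : IntegrableOn f (Ioi 0) :=
    IntegrableOn.congr_fun ((integrableOn_temperedStable hβp1 hlamp ξ).const_mul (αp : ℂ))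
      hpos measurableSet_Ioi
  have hIm : IntegrableOn f (Iio 0) := by
    have h : IntegrableOn (fun x ↦ f (-x)) (Ioi (-0)) := by
      rw [neg_zero]
      exact IntegrableOn.congr_fun
        ((integrableOn_temperedStable hβm1 hlamm (-ξ)).const_mul (αm : ℂ)) hneg measurableSet_Ioi
    simpa using h.comp_neg_Iio
  have hunion : ({0}ᶜ : Set ℝ) = Iio 0 ∪ Ioi 0 := by rw [Iio_union_Ioi]
  have hdisj : Disjoint (Iio (0 : ℝ)) (Ioi 0) := disjoint_left.2 fun _ h k ↦ lt_asymm (mem_Iio.1 h) (mem_Ioi.1 k)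
  rw [hunion]
  refine ⟨hIm.union hIp, ?_⟩
  have hm : ∫ x in Iio 0, f x = ∫ x in Ioi 0, f (-x) := by
    rw [integral_comp_neg_Ioi, neg_zero, integral_Iic_eq_integral_Iio]
  rw [setIntegral_union hdisj measurableSet_Ioi hIm hIp, hm,
    ← setIntegral_congr_fun measurableSet_Ioi hpos, ← setIntegral_congr_fun measurableSet_Ioi hneg,
    integral_const_mul, integral_const_mul, integral_temperedStable hβp0 hβp1 hlamp,
    integral_temperedStable hβm0 hβm1 hlamm]
  push_cast
  ring_nf
end

section
/- Let f : ℝ → ℝ be a (Lebesgue) integrable probability density function with cumulative distribution function F(x) = ∫_{−∞}^x f(t) dt, and let φ(y) = ∫_ℝ e^{iyt} f(t) dt be its characteristic function. Then for every x ∈ ℝ at which F is continuous, F(x) = 1/2 − (1/π) · lim_{ε→0⁺, T→∞} ∫_ε^T Im(e^{−iyx} · φ(y)) / y dy (the Gil-Pelaez inversion formula), so that the cumulative distribution function is recovered from the Fourier transform of the density by F(x) = 1/2 + (1/2π) · PV ∫_ℝ φ(y) · e^{−iyx} / (−iy) dy. -/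
open MeasureTheory Set Filter

lemma integral_exp_neg_mul_mul_sin (s T : ℝ) :
    ∫ y in (0 : ℝ)..T, Real.exp (-y * s) * Real.sin y =
      (1 + s ^ 2)⁻¹ - Real.exp (-T * s) * (s * Real.sin T + Real.cos T) / (1 + s ^ 2) := by
  have hs : 1 + s ^ 2 ≠ 0 := by positivity
  have hderiv : ∀ y : ℝ, HasDerivAt
      (fun y => -(Real.exp (-y * s) * (s * Real.sin y + Real.cos y)) / (1 + s ^ 2))
      (Real.exp (-y * s) * Real.sin y) y := by
    intro y
    have hexp : HasDerivAt (fun y => Real.exp (-y * s)) (Real.exp (-y * s) * (-1 * s)) y :=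
      (((hasDerivAt_id y).neg).mul_const s).exp
    have htrig := ((Real.hasDerivAt_sin y).const_mul s).add (Real.hasDerivAt_cos y)
    refine ((hexp.mul htrig).neg.div_const (1 + s ^ 2)).congr_deriv ?_
    simp only [Pi.add_apply]
    field_simp
    ring
  rw [intervalIntegral.integral_eq_sub_of_hasDerivAt (fun y _ => hderiv y)
    (Continuous.intervalIntegrable (by fun_prop) _ _)]
  simp
  ring

lemma integrable_exp_neg_mul_mul_sin (T : ℝ) :
    Integrable (Function.uncurry fun y s : ℝ => Real.exp (-y * s) * Real.sin y)
      ((volume.restrict (Ioc 0 T)).prod (volume.restrict (Ioi 0))) := by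
  rw [integrable_prod_iff (Continuous.aestronglyMeasurable (by fun_prop))]
  constructor
  · filter_upwards [ae_restrict_mem measurableSet_Ioc] with y hy
    exact (integrableOn_exp_mul_Ioi (neg_lt_zero.mpr hy.1) 0).mul_const (Real.sin y)
  · have heq : ∀ᵐ y ∂volume.restrict (Ioc 0 T), |Real.sinc y| =
        ∫ s, ‖Function.uncurry (fun y s : ℝ => Real.exp (-y * s) * Real.sin y) (y, s)‖
          ∂volume.restrict (Ioi 0) := by
      filter_upwards [ae_restrict_mem measurableSet_Ioc] with y hy
      simp only [Function.uncurry, norm_mul, Real.norm_eq_abs, Real.abs_exp]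
      rw [integral_mul_const, integral_exp_mul_Ioi (neg_lt_zero.mpr hy.1),
        Real.sinc_of_ne_zero hy.1.ne', abs_div, abs_of_pos hy.1]
      simp
      ring
    refine Integrable.congr ?_ heq
    have hc : Continuous fun y => |Real.sinc y| := Real.continuous_sinc.abs
    exact (hc.intervalIntegrable 0 T).1

lemma integral_sinc_eq {T : ℝ} (hT : 0 < T) :
    ∫ y in (0 : ℝ)..T, Real.sinc y = Real.pi / 2 -
      ∫ s in Ioi (0 : ℝ), Real.exp (-T * s) * (s * Real.sin T + Real.cos T) / (1 + s ^ 2) := by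
  have hswap := integral_integral_swap (integrable_exp_neg_mul_mul_sin T)
  have hleft : ∫ y in Ioc 0 T, ∫ s in Ioi (0 : ℝ), Real.exp (-y * s) * Real.sin y =
      ∫ y in Ioc 0 T, Real.sinc y := by
    refine setIntegral_congr_fun measurableSet_Ioc fun y hy => ?_
    rw [integral_mul_const, integral_exp_mul_Ioi (neg_lt_zero.mpr hy.1),
      Real.sinc_of_ne_zero hy.1.ne']
    simp
    ring
  rw [intervalIntegral.integral_of_le hT.le, ← hleft, hswap]
  simp_rw [← intervalIntegral.integral_of_le hT.le, integral_exp_neg_mul_mul_sin]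
  rw [integral_sub integrable_inv_one_add_sq.integrableOn, integral_Ioi_inv_one_add_sq]
  · simp
  · have hint := (integrable_exp_neg_mul_mul_sin T).integral_prod_right
    simp only [Function.uncurry, ← intervalIntegral.integral_of_le hT.le,
      integral_exp_neg_mul_mul_sin] at hint
    refine (integrable_inv_one_add_sq.integrableOn.sub hint).congr (ae_of_all _ fun s => ?_)
    simp

lemma tendsto_integral_sinc_atTop :
    Tendsto (fun T : ℝ => ∫ y in (0 : ℝ)..T, Real.sinc y) atTop (nhds (Real.pi / 2)) := by
  have hrem : Tendsto (fun T : ℝ => ∫ s in Ioi (0 : ℝ),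
      Real.exp (-T * s) * (s * Real.sin T + Real.cos T) / (1 + s ^ 2)) atTop (nhds 0) := by
    refine squeeze_zero_norm' (a := fun T => 2 / T) ?_ (tendsto_const_nhds.div_atTop tendsto_id)
    filter_upwards [eventually_gt_atTop 0] with T hT
    have hmaj : ∫ s in Ioi (0 : ℝ), Real.exp (-T * s) * 2 = 2 / T := by
      rw [integral_mul_const, integral_exp_mul_Ioi (neg_lt_zero.mpr hT)]
      simp
      ring
    rw [← hmaj]
    refine norm_integral_le_of_norm_le
      ((integrableOn_exp_mul_Ioi (neg_lt_zero.mpr hT) 0).mul_const 2) ?_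
    filter_upwards [ae_restrict_mem measurableSet_Ioi] with s hs
    have hs : 0 < s := hs
    rw [mul_div_assoc, norm_mul, Real.norm_eq_abs, Real.abs_exp, Real.norm_eq_abs, abs_div,
      abs_of_pos (by positivity : 0 < 1 + s ^ 2)]
    gcongr
    rw [div_le_iff₀ (by positivity)]
    have hsin := Real.abs_sin_le_one T
    have hcos := Real.abs_cos_le_one T
    calc |s * Real.sin T + Real.cos T| ≤ |s * Real.sin T| + |Real.cos T| := abs_add_le _ _
      _ = s * |Real.sin T| + |Real.cos T| := by rw [abs_mul, abs_of_pos hs]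
      _ ≤ 2 * (1 + s ^ 2) := by nlinarith [sq_nonneg (s - 1)]
  have hlim := tendsto_const_nhds (x := Real.pi / 2).sub hrem
  rw [sub_zero] at hlim
  refine hlim.congr' ?_
  filter_upwards [eventually_gt_atTop 0] with T hT
  exact (integral_sinc_eq hT).symm

lemma integral_sinc_neg (T : ℝ) :
    ∫ y in (0 : ℝ)..-T, Real.sinc y = -∫ y in (0 : ℝ)..T, Real.sinc y := by
  have h := intervalIntegral.integral_comp_neg (a := 0) (b := T) Real.sinc
  simp only [Real.sinc_neg, neg_zero] at h
  rw [h, intervalIntegral.integral_symm]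

lemma continuous_integral_sinc : Continuous fun T : ℝ => ∫ y in (0 : ℝ)..T, Real.sinc y :=
  intervalIntegral.continuous_primitive
    (fun _ _ => Real.continuous_sinc.intervalIntegrable _ _) 0

lemma exists_abs_integral_sinc_le : ∃ C, ∀ T : ℝ, |∫ y in (0 : ℝ)..T, Real.sinc y| ≤ C := by
  obtain ⟨N, hN⟩ := eventually_atTop.mp
    (tendsto_integral_sinc_atTop.abs.eventually_lt_const
      (lt_add_one |Real.pi / 2|))
  obtain ⟨C, hC⟩ := (isCompact_Icc (a := 0) (b := N)).exists_bound_of_continuousOn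
    continuous_integral_sinc.continuousOn
  have hpos : ∀ T : ℝ, 0 ≤ T →
      |∫ y in (0 : ℝ)..T, Real.sinc y| ≤ max C (|Real.pi / 2| + 1) := by
    intro T hT
    rcases le_total N T with h | h
    · exact (hN T h).le.trans (le_max_right _ _)
    · exact (hC T ⟨hT, h⟩).trans (le_max_left _ _)
  refine ⟨max C (|Real.pi / 2| + 1), fun T => ?_⟩
  rcases le_total 0 T with hT | hT
  · exact hpos T hT
  · have h := hpos (-T) (neg_nonneg.mpr hT)
    rwa [integral_sinc_neg, abs_neg] at h

lemma integral_sin_mul_div {ε T : ℝ} (hε : 0 < ε) (hT : ε ≤ T) (a : ℝ) :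
    ∫ y in ε..T, Real.sin (y * a) / y =
      (∫ y in (0 : ℝ)..a * T, Real.sinc y) - ∫ y in (0 : ℝ)..a * ε, Real.sinc y := by
  have hcongr : ∫ y in ε..T, Real.sin (y * a) / y = ∫ y in ε..T, a * Real.sinc (a * y) := by
    refine intervalIntegral.integral_congr fun y hy => ?_
    rw [uIcc_of_le hT] at hy
    have hy0 : y ≠ 0 := (hε.trans_le hy.1).ne'
    rcases eq_or_ne a 0 with rfl | ha
    · simp
    · rw [Real.sinc_of_ne_zero (mul_ne_zero ha hy0), mul_comm y a]
      field_simp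
  rw [hcongr, intervalIntegral.integral_const_mul, intervalIntegral.mul_integral_comp_mul_left,
    intervalIntegral.integral_interval_sub_left] <;>
  exact Real.continuous_sinc.intervalIntegrable _ _

lemma tendsto_integral_sinc_mul_atTop (a : ℝ) :
    Tendsto (fun T : ℝ => ∫ y in (0 : ℝ)..a * T, Real.sinc y) atTop
      (nhds (SignType.sign a * (Real.pi / 2))) := by
  rcases lt_trichotomy a 0 with ha | rfl | ha
  · have h := (tendsto_integral_sinc_atTop.comp
      (tendsto_id.const_mul_atTop (neg_pos.mpr ha))).neg
    simpa [sign_neg ha, Function.comp_def, integral_sinc_neg] using h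
  · simp
  · simpa [sign_pos ha, Function.comp_def] using tendsto_integral_sinc_atTop.comp (tendsto_id.const_mul_atTop ha)

lemma tendsto_integral_sinc_mul_sub (a : ℝ) :
    Tendsto (fun p : ℝ × ℝ => (∫ y in (0 : ℝ)..a * p.2, Real.sinc y) -
        ∫ y in (0 : ℝ)..a * p.1, Real.sinc y)
      ((nhdsWithin 0 (Ioi (0 : ℝ))) ×ˢ atTop) (nhds (SignType.sign a * (Real.pi / 2))) := by
  have hzero : Tendsto (fun ε : ℝ => ∫ y in (0 : ℝ)..a * ε, Real.sinc y)
      (nhdsWithin 0 (Ioi 0)) (nhds 0) := by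
    have hc : Continuous fun ε : ℝ => ∫ y in (0 : ℝ)..a * ε, Real.sinc y :=
      continuous_integral_sinc.comp (continuous_const_mul a)
    simpa using (hc.tendsto 0).mono_left nhdsWithin_le_nhds
  simpa using ((tendsto_integral_sinc_mul_atTop a).comp tendsto_snd).sub (hzero.comp tendsto_fst)

lemma integral_sign_sub_mul {f : ℝ → ℝ} (hf : Integrable f) (x : ℝ) :
    ∫ t, (SignType.sign (t - x) : ℝ) * f t = (∫ t, f t) - 2 * ∫ t in Iio x, f t := by
  rw [← integral_indicator measurableSet_Iio, ← integral_const_mul,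
    ← integral_sub hf ((hf.indicator measurableSet_Iio).const_mul 2)]
  refine integral_congr_ae ?_
  filter_upwards [Measure.ae_ne volume x] with t ht
  rcases ht.lt_or_gt with h | h
  · rw [sign_neg (sub_neg.mpr h), indicator_of_mem (mem_Iio.mpr h)]
    simp
    ring
  · rw [sign_pos (sub_pos.mpr h), indicator_of_notMem (notMem_Iio.mpr h.le)]
    simp

lemma norm_exp_I_mul_mul (y t : ℝ) : ‖Complex.exp (Complex.I * y * t)‖ = 1 := by
  rw [mul_assoc, mul_comm, ← Complex.ofReal_mul, Complex.norm_exp_ofReal_mul_I]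

lemma integrable_exp_I_mul_mul {f : ℝ → ℝ} (hf : Integrable f) (y : ℝ) :
    Integrable fun t : ℝ => Complex.exp (Complex.I * y * t) * f t :=
  hf.ofReal.bdd_mul (Continuous.aestronglyMeasurable (by fun_prop))
    (ae_of_all _ fun t => (norm_exp_I_mul_mul y t).le)

lemma continuous_integral_exp_I_mul_mul {f : ℝ → ℝ} (hf : Integrable f) :
    Continuous fun y : ℝ => ∫ t : ℝ, Complex.exp (Complex.I * y * t) * f t := by
  refine continuous_of_dominated (bound := fun t => ‖f t‖)
    (fun y => (integrable_exp_I_mul_mul hf y).aestronglyMeasurable)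
    (fun y => ae_of_all _ fun t => ?_) hf.norm (ae_of_all _ fun t => by fun_prop)
  rw [norm_mul, norm_exp_I_mul_mul, one_mul, Complex.norm_real]

lemma im_exp_mul_integral_exp {f : ℝ → ℝ} (hf : Integrable f) (x y : ℝ) :
    (Complex.exp (-Complex.I * y * x) * ∫ t : ℝ, Complex.exp (Complex.I * y * t) * f t).im =
      ∫ t, Real.sin (y * (t - x)) * f t := by
  rw [← integral_const_mul]
  refine (integral_im ((integrable_exp_I_mul_mul hf y).const_mul _)).symm.trans
    (integral_congr_ae (ae_of_all _ fun t => ?_))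
  have hexp : Complex.exp (-Complex.I * y * x) * (Complex.exp (Complex.I * y * t) * f t) =
      Complex.exp ((y * (t - x) : ℝ) * Complex.I) * f t := by
    rw [← mul_assoc, ← Complex.exp_add]
    push_cast
    ring_nf
  change (Complex.exp (-Complex.I * y * x) * (Complex.exp (Complex.I * y * t) * f t)).im = _
  rw [hexp, Complex.im_mul_ofReal, Complex.exp_ofReal_mul_I_im]

lemma integrable_sin_mul_div_mul {f : ℝ → ℝ} (hf : Integrable f) (x : ℝ) {ε : ℝ} (hε : 0 < ε)
    (T : ℝ) :
    Integrable (Function.uncurry fun y t : ℝ => Real.sin (y * (t - x)) / y * f t)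
      ((volume.restrict (Ioc ε T)).prod volume) := by
  have hmaj : Integrable (fun p : ℝ × ℝ => ε⁻¹ * f p.2)
      ((volume.restrict (Ioc ε T)).prod volume) :=
    (integrable_const (μ := volume.restrict (Ioc ε T)) ε⁻¹).mul_prod hf
  refine hmaj.mono ?_ ?_
  · have hmeas : Measurable fun p : ℝ × ℝ => Real.sin (p.1 * (p.2 - x)) / p.1 := by fun_prop
    exact hmeas.aestronglyMeasurable.mul hf.aestronglyMeasurable.comp_snd
  · have hmem : ∀ᵐ p ∂(volume.restrict (Ioc ε T)).prod (volume : Measure ℝ), p.1 ∈ Ioc ε T :=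
      Measure.quasiMeasurePreserving_fst.ae (ae_restrict_mem measurableSet_Ioc)
    filter_upwards [hmem] with p hp
    have hp0 : 0 < p.1 := hε.trans hp.1
    simp only [Function.uncurry, norm_mul, Real.norm_eq_abs, abs_div, abs_of_pos hp0, abs_inv,
      abs_of_pos hε]
    gcongr
    rw [← one_div]
    exact div_le_div₀ zero_le_one (Real.abs_sin_le_one _) hε hp.1.le

lemma integral_im_exp_mul_div {f : ℝ → ℝ} (hf : Integrable f) (x : ℝ) {ε T : ℝ} (hε : 0 < ε)
    (hT : ε ≤ T) :
    ∫ y in ε..T, (Complex.exp (-Complex.I * y * x) *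
        ∫ t : ℝ, Complex.exp (Complex.I * y * t) * f t).im / y =
      ∫ t, ((∫ y in (0 : ℝ)..(t - x) * T, Real.sinc y) -
        ∫ y in (0 : ℝ)..(t - x) * ε, Real.sinc y) * f t := by
  simp_rw [im_exp_mul_integral_exp hf, ← integral_div]
  rw [intervalIntegral.integral_of_le hT]
  have hswap := integral_integral_swap (integrable_sin_mul_div_mul hf x hε T)
  simp_rw [mul_div_right_comm]
  rw [hswap]
  refine integral_congr_ae (ae_of_all _ fun t => ?_)
  simp only
  rw [integral_mul_const, ← intervalIntegral.integral_of_le hT, integral_sin_mul_div hε hT]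

lemma eventually_pos_and_lt :
    ∀ᶠ p : ℝ × ℝ in (nhdsWithin 0 (Ioi (0 : ℝ))) ×ˢ atTop, 0 < p.1 ∧ p.1 < p.2 := by
  have h1 : ∀ᶠ ε : ℝ in nhdsWithin 0 (Ioi 0), 0 < ε ∧ ε < 1 :=
    Ioo_mem_nhdsGT one_pos
  filter_upwards [h1.prod_mk (eventually_gt_atTop (1 : ℝ))] with p hp
  exact ⟨hp.1.1, hp.1.2.trans hp.2⟩

lemma tendsto_integral_im_exp_mul_div {f : ℝ → ℝ} (hf : Integrable f) (x : ℝ) :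
    Tendsto
      (fun p : ℝ × ℝ => ∫ y in p.1..p.2, (Complex.exp (-Complex.I * y * x) *
        ∫ t : ℝ, Complex.exp (Complex.I * y * t) * f t).im / y)
      ((nhdsWithin 0 (Ioi (0 : ℝ))) ×ˢ atTop)
      (nhds (Real.pi / 2 * ((∫ t, f t) - 2 * ∫ t in Iio x, f t))) := by
  obtain ⟨C, hC⟩ := exists_abs_integral_sinc_le
  have hlim : Tendsto
      (fun p : ℝ × ℝ => ∫ t, ((∫ y in (0 : ℝ)..(t - x) * p.2, Real.sinc y) -
        ∫ y in (0 : ℝ)..(t - x) * p.1, Real.sinc y) * f t)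
      ((nhdsWithin 0 (Ioi (0 : ℝ))) ×ˢ atTop)
      (nhds (∫ t, (SignType.sign (t - x) : ℝ) * (Real.pi / 2) * f t)) := by
    refine tendsto_integral_filter_of_dominated_convergence (fun t => (C + C) * ‖f t‖)
      (Eventually.of_forall fun p => ?_) (Eventually.of_forall fun p => ae_of_all _ fun t => ?_)
      (hf.norm.const_mul _)
      (ae_of_all _ fun t => (tendsto_integral_sinc_mul_sub (t - x)).mul_const _)
    · have hc : ∀ c : ℝ, Continuous fun t : ℝ => ∫ y in (0 : ℝ)..(t - x) * c, Real.sinc y :=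
        fun c => continuous_integral_sinc.comp (by fun_prop)
      exact ((hc p.2).sub (hc p.1)).aestronglyMeasurable.mul hf.aestronglyMeasurable
    · rw [norm_mul]
      gcongr
      exact (abs_sub _ _).trans (add_le_add (hC _) (hC _))
  have hval : ∫ t, (SignType.sign (t - x) : ℝ) * (Real.pi / 2) * f t =
      Real.pi / 2 * ((∫ t, f t) - 2 * ∫ t in Iio x, f t) := by
    rw [← integral_sign_sub_mul hf, ← integral_const_mul]
    congr 1 with t
    ring
  rw [hval] at hlim
  refine hlim.congr' ?_
  filter_upwards [eventually_pos_and_lt] with p hp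
  exact (integral_im_exp_mul_div hf x hp.1 hp.2.le).symm

lemma Ioo_neg_diff_Icc_neg {ε T : ℝ} (hε : 0 < ε) (hT : ε < T) :
    Ioo (-T) T \ Icc (-ε) ε = Ioo (-T) (-ε) ∪ Ioo ε T := by
  grind

lemma setIntegral_Ioo_diff_Icc {E : Type*} [NormedAddCommGroup E] [NormedSpace ℝ E]
    {g : ℝ → E} (hg : ContinuousOn g {0}ᶜ) {ε T : ℝ} (hε : 0 < ε) (hT : ε < T) :
    ∫ y in Ioo (-T) T \ Icc (-ε) ε, g y = ∫ y in ε..T, (g (-y) + g y) := by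
  have hpos : IntervalIntegrable g volume ε T := by
    refine (hg.mono fun y hy => ?_).intervalIntegrable
    rw [uIcc_of_le hT.le] at hy
    exact (hε.trans_le hy.1).ne'
  have hneg : IntervalIntegrable g volume (-T) (-ε) := by
    refine (hg.mono fun y hy => ?_).intervalIntegrable
    rw [uIcc_of_le (neg_le_neg hT.le)] at hy
    exact (hy.2.trans_lt (neg_lt_zero.mpr hε)).ne
  have hneg' : IntervalIntegrable (fun y => g (-y)) volume ε T := by
    refine ContinuousOn.intervalIntegrable ?_
    refine hg.comp continuousOn_neg fun y hy => ?_
    rw [uIcc_of_le hT.le] at hy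
    exact neg_ne_zero.mpr (hε.trans_le hy.1).ne'
  have hdisj : Disjoint (Ioo (-T) (-ε)) (Ioo ε T) := by
    rw [Set.disjoint_left]
    intro y hy hy'
    linarith [hy.2, hy'.1]
  rw [Ioo_neg_diff_Icc_neg hε hT, setIntegral_union hdisj measurableSet_Ioo
      (hneg.1.mono_set Ioo_subset_Ioc_self) (hpos.1.mono_set Ioo_subset_Ioc_self),
    ← integral_Ioc_eq_integral_Ioo, ← integral_Ioc_eq_integral_Ioo,
    ← intervalIntegral.integral_of_le (neg_le_neg hT.le),
    ← intervalIntegral.integral_of_le hT.le, intervalIntegral.integral_add hneg' hpos,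
    intervalIntegral.integral_comp_neg]

lemma integral_exp_neg_mul_eq_conj (f : ℝ → ℝ) (y : ℝ) :
    ∫ t : ℝ, Complex.exp (Complex.I * (-y : ℝ) * t) * f t =
      starRingEnd ℂ (∫ t : ℝ, Complex.exp (Complex.I * y * t) * f t) := by
  rw [← integral_conj]
  congr 1 with t
  simp [← Complex.exp_conj]

lemma conj_symm_add_div_neg_I_mul (z : ℂ) (x y : ℝ) :
    starRingEnd ℂ z * Complex.exp (-Complex.I * (-y : ℝ) * x) / (-Complex.I * (-y : ℝ)) +
        z * Complex.exp (-Complex.I * y * x) / (-Complex.I * y) =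
      ((-2 * ((Complex.exp (-Complex.I * y * x) * z).im / y) : ℝ) : ℂ) := by
  have hconj : starRingEnd ℂ z * Complex.exp (-Complex.I * (-y : ℝ) * x) =
      starRingEnd ℂ (Complex.exp (-Complex.I * y * x) * z) := by
    rw [map_mul, ← Complex.exp_conj, mul_comm]
    simp
  rw [hconj, mul_comm z]
  generalize Complex.exp (-Complex.I * y * x) * z = w
  rcases eq_or_ne y 0 with rfl | hy
  · simp
  have hw : w - starRingEnd ℂ w = 2 * w.im * Complex.I := by
    rw [Complex.sub_conj]
    push_cast
    ring
  have hyc : (y : ℂ) ≠ 0 := Complex.ofReal_ne_zero.mpr hy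
  push_cast
  field_simp
  linear_combination -hw
/-- Gil-Pelaez inversion: Let `f` be an integrable probability density on
`ℝ` with CDF `F(x) = ∫_{−∞}^x f` and characteristic function `φ(y) = ∫ e^{iyt} f(t) dt`.
At every continuity point `x` of `F`,
`F(x) = 1/2 − (1/π) · lim_{ε→0⁺, T→∞} ∫_ε^T Im(e^{−iyx} φ(y))/y dy`,
equivalently `F(x) = 1/2 + (1/2π) · PV ∫_ℝ φ(y) e^{−iyx}/(−iy) dy`, where the principal
value is the joint limit over symmetric truncations excluding a symmetric neighborhood
of the origin.  The two limits are stated as: the first integral tends to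
`π (1/2 − F x)` and the symmetric-truncation integral tends to `2π (F x − 1/2)`. -/
theorem gil_pelaez_inversion
    (f : ℝ → ℝ) (hf_int : Integrable f) (hf_nonneg : ∀ x, 0 ≤ f x)
    (hf_one : ∫ x, f x = 1)
    (F : ℝ → ℝ) (hF : ∀ x, F x = ∫ t in Iio x, f t)
    (φ : ℝ → ℂ) (hφ : ∀ y : ℝ, φ y = ∫ t : ℝ, Complex.exp (Complex.I * y * t) * f t)
    (x : ℝ) (hcont : ContinuousAt F x) :
    Tendsto
      (fun p : ℝ × ℝ =>
        ∫ y in p.1..p.2, (Complex.exp (-(Complex.I) * y * x) * φ y).im / y)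
      ((nhdsWithin 0 (Ioi (0 : ℝ))) ×ˢ atTop)
      (nhds (Real.pi * (1 / 2 - F x))) ∧
    Tendsto
      (fun p : ℝ × ℝ =>
        ∫ y in (Ioo (-p.2) p.2 \ Icc (-p.1) p.1),
          φ y * Complex.exp (-(Complex.I) * y * x) / (-(Complex.I) * y))
      ((nhdsWithin 0 (Ioi (0 : ℝ))) ×ˢ atTop)
      (nhds ((2 * Real.pi * (F x - 1 / 2) : ℝ) : ℂ)) := by
  obtain rfl : φ = fun y : ℝ => ∫ t : ℝ, Complex.exp (Complex.I * y * t) * f t := funext hφ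
  have hfirst := tendsto_integral_im_exp_mul_div hf_int x
  rw [hf_one, ← hF x,
    show Real.pi / 2 * (1 - 2 * F x) = Real.pi * (1 / 2 - F x) by ring] at hfirst
  refine ⟨hfirst, ?_⟩
  have hlim := (Complex.continuous_ofReal.tendsto _).comp (hfirst.const_mul (-2))
  rw [show -2 * (Real.pi * (1 / 2 - F x)) = 2 * Real.pi * (F x - 1 / 2) by ring] at hlim
  refine hlim.congr' ?_
  filter_upwards [eventually_pos_and_lt] with p hp
  have hcontOn : ContinuousOn (fun y : ℝ =>
      (∫ t : ℝ, Complex.exp (Complex.I * y * t) * f t) * Complex.exp (-Complex.I * y * x) /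
        (-Complex.I * y)) {0}ᶜ := by
    refine ContinuousOn.div ?_ (by fun_prop) fun y hy => ?_
    · exact ((continuous_integral_exp_I_mul_mul hf_int).mul (by fun_prop)).continuousOn
    · exact mul_ne_zero (neg_ne_zero.mpr Complex.I_ne_zero) (Complex.ofReal_ne_zero.mpr hy)
  rw [setIntegral_Ioo_diff_Icc hcontOn hp.1 hp.2]
  simp_rw [integral_exp_neg_mul_eq_conj, conj_symm_add_div_neg_I_mul]
  rw [intervalIntegral.integral_ofReal, intervalIntegral.integral_const_mul]
  rfl
end
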